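/- arXiv:1602.06518 — 2 statements merged into one kernel-verified Lean document; each statement's English description precedes it below -/
import Mathlib

section
/- Let I ⊆ {1,…,T} be a set of labeled tasks and α^1,…,α^T ∈ Λ^I be weight vectors. Then for any hypotheses h_1,…,h_T ∈ H: (1/T)Σ_{t=1}^T er_t(h_t) ≤ (1/T)Σ_{t=1}^T er_{α^t}(h_t) + (1/T)Σ_{t=1}^T Σ_{i∈I} α_i^t disc(D_t,D_i) + (1/T)Σ_{t=1}^T Σ_{i∈I} α_i^t λ_{ti}. -/
open MeasureTheory Finset

noncomputable section

/-- The 0/1 loss on labels in `{-1,1} ⊆ ℤ`. -/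
def loss01 (y y' : ℤ) : ℝ := if y = y' then 0 else 1

/-- Expected risk of hypothesis `h` on the task `⟨D, f⟩`. -/
def expRisk {X : Type*} [MeasurableSpace X] (D : Measure X) (f h : X → ℤ) : ℝ :=
  ∫ x, loss01 (h x) (f x) ∂D

/-- Discrepancy between two distributions w.r.t. hypothesis class `H`:
`disc(D,D') = sup_{h,h'∈H} |E_D ℓ(h,h') − E_{D'} ℓ(h,h')|`. -/
def discD {X : Type*} [MeasurableSpace X] (H : Set (X → ℤ)) (D D' : Measure X) : ℝ :=
  ⨆ p : H × H,
    |(∫ x, loss01 ((p.1 : X → ℤ) x) ((p.2 : X → ℤ) x) ∂D)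
      - ∫ x, loss01 ((p.1 : X → ℤ) x) ((p.2 : X → ℤ) x) ∂D'|

/-- `λ_{ij} = inf_{h ∈ H} (er_i(h) + er_j(h))`. -/
def lambdaPair {X : Type*} [MeasurableSpace X] (H : Set (X → ℤ))
    (D D' : Measure X) (f f' : X → ℤ) : ℝ :=
  ⨅ h : H, (expRisk D f h + expRisk D' f' h)

/-- `α ∈ Λ^I`: entries in `[0,1]`, summing to one, supported in `I`. -/
def memSimplexOn {T : ℕ} (I : Finset (Fin T)) (α : Fin T → ℝ) : Prop :=
  (∀ i, 0 ≤ α i ∧ α i ≤ 1) ∧ (∑ i, α i = 1) ∧ (∀ i, α i ≠ 0 → i ∈ I)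


/-- `er_α(h) = Σ_{i∈I} α_i er_i(h)` for `α ∈ Λ^I`. -/
def weightedRisk {X : Type*} [MeasurableSpace X] {T : ℕ} (I : Finset (Fin T))
    (α : Fin T → ℝ) (P : Fin T → Measure X) (f : Fin T → X → ℤ) (h : X → ℤ) : ℝ :=
  ∑ i ∈ I, α i * expRisk (P i) (f i) h

lemma loss01_nonneg (a b : ℤ) : 0 ≤ loss01 a b := by
  unfold loss01; split_ifs <;> norm_num

lemma loss01_le_one (a b : ℤ) : loss01 a b ≤ 1 := by
  unfold loss01; split_ifs <;> norm_num

lemma loss01_comm (a b : ℤ) : loss01 a b = loss01 b a := by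
  simp only [loss01, eq_comm]

lemma loss01_triangle (a b c : ℤ) : loss01 a c ≤ loss01 a b + loss01 b c := by
  unfold loss01; split_ifs <;> first | omega | norm_num

section Risk

variable {X : Type*} [MeasurableSpace X]

lemma integrable_loss01 (D : Measure X) [IsFiniteMeasure D] {u v : X → ℤ}
    (hu : Measurable u) (hv : Measurable v) : Integrable (fun x => loss01 (u x) (v x)) D := by
  refine Integrable.of_bound (C := 1) ?_ (ae_of_all _ fun x => ?_)
  · exact (Measurable.ite (measurableSet_eq_fun hu hv) measurable_const
      measurable_const).aestronglyMeasurable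
  · rw [Real.norm_of_nonneg (loss01_nonneg _ _)]
    exact loss01_le_one _ _

lemma integral_loss01_nonneg (D : Measure X) (u v : X → ℤ) :
    0 ≤ ∫ x, loss01 (u x) (v x) ∂D :=
  integral_nonneg fun _ => loss01_nonneg _ _

lemma integral_loss01_le_one (D : Measure X) [IsProbabilityMeasure D] {u v : X → ℤ}
    (hu : Measurable u) (hv : Measurable v) : ∫ x, loss01 (u x) (v x) ∂D ≤ 1 := by
  simpa using integral_mono (integrable_loss01 D hu hv) (integrable_const 1)
    fun _ => loss01_le_one _ _

lemma integral_loss01_comm (D : Measure X) (u v : X → ℤ) :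
    ∫ x, loss01 (u x) (v x) ∂D = ∫ x, loss01 (v x) (u x) ∂D := by
  simp only [loss01_comm]

lemma integral_loss01_triangle (D : Measure X) [IsFiniteMeasure D] {u v w : X → ℤ}
    (hu : Measurable u) (hv : Measurable v) (hw : Measurable w) :
    ∫ x, loss01 (u x) (w x) ∂D
      ≤ (∫ x, loss01 (u x) (v x) ∂D) + ∫ x, loss01 (v x) (w x) ∂D := by
  rw [← integral_add (integrable_loss01 D hu hv) (integrable_loss01 D hv hw)]
  exact integral_mono (integrable_loss01 D hu hw)
    ((integrable_loss01 D hu hv).add (integrable_loss01 D hv hw))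
    fun _ => loss01_triangle _ _ _

lemma abs_integral_loss01_sub_le_discD {H : Set (X → ℤ)} (hH : ∀ h ∈ H, Measurable h)
    (D D' : Measure X) [IsProbabilityMeasure D] [IsProbabilityMeasure D'] {u v : X → ℤ}
    (hu : u ∈ H) (hv : v ∈ H) :
    |(∫ x, loss01 (u x) (v x) ∂D) - ∫ x, loss01 (u x) (v x) ∂D'| ≤ discD H D D' := by
  refine le_ciSup (f := fun p : H × H =>
    |(∫ x, loss01 ((p.1 : X → ℤ) x) ((p.2 : X → ℤ) x) ∂D)
      - ∫ x, loss01 ((p.1 : X → ℤ) x) ((p.2 : X → ℤ) x) ∂D'|) ⟨1, ?_⟩ (⟨u, hu⟩, ⟨v, hv⟩)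
  rintro _ ⟨⟨⟨a, ha⟩, ⟨b, hb⟩⟩, rfl⟩
  exact abs_sub_le_of_nonneg_of_le
    (integral_loss01_nonneg D a b) (integral_loss01_le_one D (hH a ha) (hH b hb))
    (integral_loss01_nonneg D' a b) (integral_loss01_le_one D' (hH a ha) (hH b hb))

lemma expRisk_le_add_discD_add_lambdaPair {H : Set (X → ℤ)} (hH : ∀ h ∈ H, Measurable h)
    (D D' : Measure X) [IsProbabilityMeasure D] [IsProbabilityMeasure D'] {f f' h : X → ℤ}
    (hf : Measurable f) (hf' : Measurable f') (hh : h ∈ H) :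
    expRisk D f h ≤ expRisk D' f' h + discD H D D' + lambdaPair H D D' f f' := by
  have : Nonempty H := ⟨⟨h, hh⟩⟩
  rw [← sub_le_iff_le_add']
  refine le_ciInf fun ⟨g, hg⟩ => ?_
  have hdisc := (le_abs_self _).trans (abs_integral_loss01_sub_le_discD hH D D' hh hg)
  have hD := integral_loss01_triangle D (hH h hh) (hH g hg) hf
  have hD' := integral_loss01_triangle D' (hH h hh) hf' (hH g hg)
  rw [integral_loss01_comm D' f' g] at hD'
  simp only [expRisk]
  linarith

end Risk

/-- For labeled tasks `I` and weights `α^1,…,α^T ∈ Λ^I`, for any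
`h_1,…,h_T ∈ H`:
`(1/T)Σ_t er_t(h_t) ≤ (1/T)Σ_t er_{α^t}(h_t) + (1/T)Σ_t Σ_{i∈I} α_i^t disc(D_t,D_i)
  + (1/T)Σ_t Σ_{i∈I} α_i^t λ_{ti}`. -/
theorem multitask_risk_transfer_bound {X : Type*} [MeasurableSpace X] {T : ℕ}
    (H : Set (X → ℤ)) (P : Fin T → Measure X) (f : Fin T → X → ℤ)
    (hP : ∀ t, IsProbabilityMeasure (P t))
    (hHmeas : ∀ h ∈ H, Measurable h) (hfmeas : ∀ t, Measurable (f t))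
    (hHrange : ∀ h ∈ H, ∀ x, h x = 1 ∨ h x = -1)
    (hfrange : ∀ t x, f t x = 1 ∨ f t x = -1)
    (I : Finset (Fin T)) (α : Fin T → Fin T → ℝ)
    (hα : ∀ t, memSimplexOn I (α t))
    (h : Fin T → X → ℤ) (hh : ∀ t, h t ∈ H) :
    (T : ℝ)⁻¹ * ∑ t, expRisk (P t) (f t) (h t)
      ≤ (T : ℝ)⁻¹ * ∑ t, weightedRisk I (α t) P f (h t)
        + (T : ℝ)⁻¹ * ∑ t, ∑ i ∈ I, α t i * discD H (P t) (P i)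
        + (T : ℝ)⁻¹ * ∑ t, ∑ i ∈ I, α t i * lambdaPair H (P t) (P i) (f t) (f i) := by
  rw [← mul_add, ← mul_add, ← sum_add_distrib, ← sum_add_distrib]
  refine mul_le_mul_of_nonneg_left (sum_le_sum fun t _ => ?_) (by positivity)
  obtain ⟨hbound, hsum, hsupp⟩ := hα t
  have hsumI : ∑ i ∈ I, α t i = 1 := by
    rw [← hsum]
    exact sum_subset (subset_univ I) fun i _ hi => by_contra fun h0 => hi (hsupp i h0)
  rw [weightedRisk, ← sum_add_distrib, ← sum_add_distrib,
    ← one_mul (expRisk (P t) (f t) (h t)), ← hsumI, sum_mul]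
  refine sum_le_sum fun i _ => ?_
  rw [← mul_add, ← mul_add]
  have := hP t
  have := hP i
  exact mul_le_mul_of_nonneg_left (expRisk_le_add_discD_add_lambdaPair hHmeas (P t) (P i)
    (hfmeas t) (hfmeas i) (hh t)) (hbound i).1

end
end

section
/- Let V_1,…,V_k be finite sets of vectors in ℝ^L, each of size n. For each i ∈ {1,…,k}, let W_{i1},…,W_{im} be sampled from V_i uniformly without replacement and let U_{i1},…,U_{im} be sampled from V_i uniformly with replacement, where the samples corresponding to different indices i are mutually independent. Then for every continuous convex function F : ℝ^L → ℝ: E[F(Σ_{i=1}^k Σ_{j=1}^m W_{ij})] ≤ E[F(Σ_{i=1}^k Σ_{j=1}^m U_{ij})]. -/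
open Finset

/-- The number of ways to factor `g` as a self-map followed by an injection. -/
noncomputable def embeddingFactorizationCount {m n : ℕ} (g : Fin m → Fin n) : ℕ :=
  #{q : (Fin m ↪ Fin n) × (Fin m → Fin m) | q.1 ∘ q.2 = g}

lemma embeddingFactorizationCount_perm_comp {m n : ℕ} (τ : Equiv.Perm (Fin n))
    (g : Fin m → Fin n) :
    embeddingFactorizationCount (τ ∘ g) = embeddingFactorizationCount g := by
  refine (Finset.card_bij (fun q _ => (τ • q.1, q.2)) ?_ ?_ ?_).symm
  · rintro ⟨σ, p⟩ h
    simp only [mem_filter, mem_univ, true_and] at h ⊢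
    rw [← h]
    rfl
  · rintro ⟨σ, p⟩ - ⟨σ', p'⟩ - h
    simpa using h
  · rintro ⟨σ, p⟩ h
    simp only [mem_filter, mem_univ, true_and] at h
    refine ⟨(τ⁻¹ • σ, p), ?_, by simp⟩
    simp only [mem_filter, mem_univ, true_and]
    funext j
    have hj : σ (p j) = τ (g j) := congrFun h j
    simp [Function.Embedding.smul_apply, hj]

lemma embeddingFactorizationCount_embedding_comp {m n : ℕ} (σ σ' : Fin m ↪ Fin n)
    (p : Fin m → Fin m) :
    embeddingFactorizationCount (σ ∘ p) = embeddingFactorizationCount (σ' ∘ p) := by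
  have := Equiv.Perm.isMultiplyPretransitive (Fin n) m
  obtain ⟨τ, rfl⟩ := MulAction.exists_smul_eq (Equiv.Perm (Fin n)) σ σ'
  exact (embeddingFactorizationCount_perm_comp τ (σ ∘ p)).symm

lemma embeddingFactorizationCount_pos {m n : ℕ} (hm : m ≤ n) (g : Fin m → Fin n) :
    0 < embeddingFactorizationCount g := by
  have hcard : #(univ.image g) ≤ m := by
    simpa using Finset.card_image_le (s := (univ : Finset (Fin m))) (f := g)
  obtain ⟨t, hst, ht⟩ := Finset.exists_superset_card_eq hcard (by simpa using hm)
  have hex : ∀ j, ∃ i, t.orderEmbOfFin ht i = g j := fun j => by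
    have : g j ∈ Set.range (t.orderEmbOfFin ht) := by
      rw [Finset.range_orderEmbOfFin]
      exact hst (mem_image_of_mem g (mem_univ j))
    exact this
  choose p hp using hex
  exact Finset.card_pos.2 ⟨((t.orderEmbOfFin ht).toEmbedding, p), by
    simpa [Function.comp_def] using funext hp⟩

/-- Weighting each factorization of `g` by the inverse of their number recovers the plain sum. -/
lemma sum_embedding_sum_inv_count_mul {m n : ℕ} (hm : m ≤ n) (f : (Fin m → Fin n) → ℝ) :
    ∑ σ : Fin m ↪ Fin n, ∑ p : Fin m → Fin m,
      (embeddingFactorizationCount (σ ∘ p) : ℝ)⁻¹ * f (σ ∘ p) = ∑ g, f g := by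
  rw [← Fintype.sum_prod_type' (fun (σ : Fin m ↪ Fin n) (p : Fin m → Fin m) =>
      (embeddingFactorizationCount (σ ∘ p) : ℝ)⁻¹ * f (σ ∘ p)),
    ← Finset.sum_fiberwise _ (fun q : (Fin m ↪ Fin n) × (Fin m → Fin m) => ⇑q.1 ∘ q.2)]
  refine Finset.sum_congr rfl fun g _ => ?_
  have hg : (embeddingFactorizationCount g : ℝ) ≠ 0 :=
    Nat.cast_ne_zero.2 (embeddingFactorizationCount_pos hm g).ne'
  rw [Finset.sum_congr rfl (g := fun _ => (embeddingFactorizationCount g : ℝ)⁻¹ * f g)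
      fun q hq => by rw [(mem_filter.1 hq).2], Finset.sum_const, nsmul_eq_mul]
  exact mul_inv_cancel_left₀ hg (f g)

/-- A weight on self-maps invariant under relabelling the target averages `u` uniformly. -/
lemma sum_smul_sum_comp_of_invariant {E : Type*} [AddCommGroup E] [Module ℝ E] {m : ℕ}
    (w : (Fin m → Fin m) → ℝ) (hw : ∀ (π : Equiv.Perm (Fin m)) p, w (π ∘ p) = w p)
    (u : Fin m → E) :
    ∑ p, w p • ∑ j, u (p j) = (∑ p, w p) • ∑ j, u j := by
  rcases Nat.eq_zero_or_pos m with rfl | hpos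
  · simp
  have : NeZero m := ⟨hpos.ne'⟩
  have hshift (c : Fin m) : ∑ p, w p • ∑ j, u (p j + c) = ∑ p, w p • ∑ j, u (p j) := by
    refine Fintype.sum_equiv (Equiv.arrowCongr (Equiv.refl (Fin m)) (Equiv.addRight c)) _ _ fun p => ?_
    rw [← hw (Equiv.addRight c) p]
    rfl
  have hm : (m : ℝ) ≠ 0 := Nat.cast_ne_zero.2 hpos.ne'
  refine smul_right_injective E hm ?_
  calc (m : ℝ) • ∑ p, w p • ∑ j, u (p j)
      = ∑ c : Fin m, ∑ p, w p • ∑ j, u (p j + c) := by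
        simp [hshift, Nat.cast_smul_eq_nsmul]
    _ = ∑ p, w p • ∑ j : Fin m, ∑ c, u (p j + c) := by
        rw [Finset.sum_comm]
        refine Finset.sum_congr rfl fun p _ => ?_
        rw [← Finset.smul_sum, Finset.sum_comm]
    _ = ∑ p, w p • ∑ _j : Fin m, ∑ c, u c := by
        refine Finset.sum_congr rfl fun p _ => ?_
        congr 1
        exact Finset.sum_congr rfl fun j _ => Equiv.sum_comp (Equiv.addLeft (p j)) u
    _ = (m : ℝ) • ((∑ p, w p) • ∑ j, u j) := by
        rw [← Finset.sum_smul, smul_comm]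
        simp [Nat.cast_smul_eq_nsmul]

/-- Hoeffding's comparison for a single population. -/
lemma hoeffding_sampling_without_replacement {E : Type*} [AddCommGroup E] [Module ℝ E]
    {m n : ℕ} (hm : m ≤ n) (v : Fin n → E) (F : E → ℝ) (hF : ConvexOn ℝ Set.univ F) :
    (Fintype.card (Fin m ↪ Fin n) : ℝ)⁻¹ * ∑ σ : Fin m ↪ Fin n, F (∑ j, v (σ j))
      ≤ (Fintype.card (Fin m → Fin n) : ℝ)⁻¹ * ∑ g : Fin m → Fin n, F (∑ j, v (g j)) := by
  let σ₀ : Fin m ↪ Fin n := Fin.castLEEmb hm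
  let w : (Fin m → Fin m) → ℝ := fun p => (embeddingFactorizationCount (σ₀ ∘ p) : ℝ)⁻¹
  have hw (σ : Fin m ↪ Fin n) (p : Fin m → Fin m) :
      (embeddingFactorizationCount (σ ∘ p) : ℝ)⁻¹ = w p := by
    simp only [w, embeddingFactorizationCount_embedding_comp σ σ₀ p]
  have hw_pos (p : Fin m → Fin m) : 0 < w p :=
    inv_pos.2 (Nat.cast_pos.2 (embeddingFactorizationCount_pos hm _))
  have hw_inv (π : Equiv.Perm (Fin m)) (p : Fin m → Fin m) : w (π ∘ p) = w p :=
    hw (π.toEmbedding.trans σ₀) p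
  set W := ∑ p, w p with hW
  have hW_pos : 0 < W := Finset.sum_pos (fun p _ => hw_pos p) ⟨id, mem_univ _⟩
  have hsum (f : (Fin m → Fin n) → ℝ) :
      ∑ σ : Fin m ↪ Fin n, ∑ p, w p * f (σ ∘ p) = ∑ g, f g := by
    rw [← sum_embedding_sum_inv_count_mul hm f]
    simp only [hw]
  have hcard : (Fintype.card (Fin m → Fin n) : ℝ) = Fintype.card (Fin m ↪ Fin n) * W := by
    have h := hsum fun _ => 1
    simp only [mul_one, sum_const, card_univ, nsmul_eq_mul, ← hW] at h
    exact h.symm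
  have hjensen (σ : Fin m ↪ Fin n) :
      F (∑ j, v (σ j)) ≤ W⁻¹ * ∑ p, w p * F (∑ j, v (σ (p j))) := by
    have h := hF.map_centerMass_le (t := univ) (w := w) (p := fun p => ∑ j, v (σ (p j)))
      (fun p _ => (hw_pos p).le) hW_pos (fun _ _ => Set.mem_univ _)
    rw [Finset.centerMass, sum_smul_sum_comp_of_invariant w hw_inv (fun j => v (σ j)),
      inv_smul_smul₀ hW_pos.ne'] at h
    simpa [Finset.centerMass] using h
  calc _ ≤ (Fintype.card (Fin m ↪ Fin n) : ℝ)⁻¹ *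
        ∑ σ : Fin m ↪ Fin n, W⁻¹ * ∑ p, w p * F (∑ j, v (σ (p j))) := by
        gcongr with σ
        exact hjensen σ
    _ = _ := by
        rw [← Finset.mul_sum, hcard, mul_inv, mul_assoc]
        congr 2
        exact hsum fun g => F (∑ j, v (g j))

/-- Averaging over tuples, with the first coordinate split off. -/
lemma average_tuple_succ {E γ : Type*} [AddCommGroup E] [Fintype γ] {k : ℕ}
    (Z : Fin (k + 1) → γ → E) (F : E → ℝ) :
    (Fintype.card (Fin (k + 1) → γ) : ℝ)⁻¹ * ∑ σ : Fin (k + 1) → γ, F (∑ i, Z i (σ i))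
      = (Fintype.card (Fin k → γ) : ℝ)⁻¹ * ∑ σ : Fin k → γ,
        (Fintype.card γ : ℝ)⁻¹ * ∑ c, F (Z 0 c + ∑ i : Fin k, Z i.succ (σ i)) := by
  rw [← Finset.mul_sum, ← mul_assoc, ← mul_inv, Finset.sum_comm,
    ← (Fin.consEquiv fun _ => γ).sum_comp, Fintype.sum_prod_type]
  simp [Fin.consEquiv, Fin.sum_univ_succ, pow_succ]

/-- The convex order is preserved by sums of independent uniform samples. -/
lemma convexOrder_independent_sum {E α β : Type*} [AddCommGroup E] [Module ℝ E]
    [Fintype α] [Fintype β] {k : ℕ} (X : Fin k → α → E) (Y : Fin k → β → E)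
    (h : ∀ i (F : E → ℝ), ConvexOn ℝ Set.univ F →
      (Fintype.card α : ℝ)⁻¹ * ∑ a, F (X i a) ≤ (Fintype.card β : ℝ)⁻¹ * ∑ b, F (Y i b))
    (F : E → ℝ) (hF : ConvexOn ℝ Set.univ F) :
    (Fintype.card (Fin k → α) : ℝ)⁻¹ * ∑ σ : Fin k → α, F (∑ i, X i (σ i))
      ≤ (Fintype.card (Fin k → β) : ℝ)⁻¹ * ∑ g : Fin k → β, F (∑ i, Y i (g i)) := by
  induction k generalizing F with
  | zero => simp
  | succ k ih =>
    have htranslate (c : E) : ConvexOn ℝ Set.univ fun x => F (x + c) := by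
      simpa [Function.comp_def] using hF.translate_left c
    have htranslate' (c : E) : ConvexOn ℝ Set.univ fun x => F (c + x) := by
      simpa [Function.comp_def] using hF.translate_right c
    rw [average_tuple_succ X, average_tuple_succ Y]
    calc _ ≤ (Fintype.card (Fin k → α) : ℝ)⁻¹ * ∑ σ : Fin k → α,
          (Fintype.card β : ℝ)⁻¹ * ∑ b, F (Y 0 b + ∑ i : Fin k, X i.succ (σ i)) := by
          refine mul_le_mul_of_nonneg_left (Finset.sum_le_sum fun σ _ => ?_) (by positivity)
          exact h 0 _ (htranslate _)
      _ = (Fintype.card β : ℝ)⁻¹ * ∑ b, (Fintype.card (Fin k → α) : ℝ)⁻¹ *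
          ∑ σ : Fin k → α, F (Y 0 b + ∑ i : Fin k, X i.succ (σ i)) := by
          rw [← Finset.mul_sum, ← Finset.mul_sum, Finset.sum_comm, mul_left_comm]
      _ ≤ (Fintype.card β : ℝ)⁻¹ * ∑ b, (Fintype.card (Fin k → β) : ℝ)⁻¹ *
          ∑ g : Fin k → β, F (Y 0 b + ∑ i : Fin k, Y i.succ (g i)) := by
          refine mul_le_mul_of_nonneg_left (Finset.sum_le_sum fun b _ => ?_) (by positivity)
          exact ih (fun i => X i.succ) (fun i => Y i.succ) (fun i => h i.succ) _
            (htranslate' _)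
      _ = _ := by
          rw [← Finset.mul_sum, ← Finset.mul_sum, Finset.sum_comm, mul_left_comm]

/-- for `k` sets `V_1,…,V_k` of `n` vectors in `ℝ^L`, sampling `m` elements
from each `V_i` uniformly without replacement (mutually independently across `i`,
modelled as a uniformly random tuple of injections `Fin k → (Fin m ↪ Fin n)`) versus
with replacement (a uniformly random tuple of functions `Fin k → Fin m → Fin n`):
for every continuous convex `F : ℝ^L → ℝ`,
`E[F(Σ_i Σ_j W_{ij})] ≤ E[F(Σ_i Σ_j U_{ij})]`.
Both expectations are written as uniform averages over the respective finite sample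
spaces. -/
theorem hoeffding_sampling_without_replacement_groups {k n L m : ℕ}
    (hn : 0 < n) (hm : m ≤ n)
    (V : Fin k → Fin n → (Fin L → ℝ)) (F : (Fin L → ℝ) → ℝ)
    (hFcont : Continuous F) (hFconv : ConvexOn ℝ Set.univ F) :
    (Fintype.card (Fin k → (Fin m ↪ Fin n)) : ℝ)⁻¹ *
        ∑ σ : Fin k → (Fin m ↪ Fin n), F (∑ i : Fin k, ∑ j : Fin m, V i (σ i j))
      ≤ (Fintype.card (Fin k → Fin m → Fin n) : ℝ)⁻¹ *
          ∑ g : Fin k → Fin m → Fin n, F (∑ i : Fin k, ∑ j : Fin m, V i (g i j)) := by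
  exact convexOrder_independent_sum (fun i (σ : Fin m ↪ Fin n) => ∑ j, V i (σ j))
    (fun i (g : Fin m → Fin n) => ∑ j, V i (g j))
    (fun i G hG => hoeffding_sampling_without_replacement hm (V i) G hG) F hFconv
end
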